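/- arXiv:math/9805010 — 2 statements merged into one kernel-verified Lean document; each statement's English description precedes it below -/
import Mathlib

section
/- Transformation of a nonterminating Saalschützian ₃F₂(1) into a ₃F₂(1) with an upper parameter 1: let a, b, c, e ∈ ℂ with Re a > 0 and with e, a+b+c−e+1, b+1, c+1 not nonpositive integers. Then ∑_{k=0}^∞ (a)_k (b)_k (c)_k / ((e)_k (a+b+c−e+1)_k · k!) = [Γ(e) Γ(a+b+c−e+1) / (Γ(a) Γ(b+1) Γ(c+1))] · ∑_{k=0}^∞ (e−a)_k (b+c−e+1)_k (1)_k / ((b+1)_k (c+1)_k · k!), where both series converge absolutely. -/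
open Complex

/-- Pochhammer symbol `(a)_k = a (a+1) ⋯ (a+k-1)`. -/
noncomputable def poch (a : ℂ) (k : ℕ) : ℂ := ∏ i ∈ Finset.range k, (a + i)

theorem poch_succ (s : ℂ) (n : ℕ) : poch s (n + 1) = poch s n * (s + n) :=
  Finset.prod_range_succ _ _

theorem poch_add (s : ℂ) (m n : ℕ) : poch s (m + n) = poch s m * poch (s + m) n := by
  simp [poch, Finset.prod_range_add, add_assoc]

theorem poch_succ' (s : ℂ) (n : ℕ) : poch s (n + 1) = s * poch (s + 1) n := by
  rw [add_comm, poch_add]; simp [poch]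

theorem poch_ne_zero {s : ℂ} (hs : ∀ m : ℕ, s ≠ -(m : ℂ)) (n : ℕ) : poch s n ≠ 0 :=
  Finset.prod_ne_zero_iff.2 fun i _ h => hs i (eq_neg_of_add_eq_zero_left h)

theorem poch_one (n : ℕ) : poch 1 n = (n.factorial : ℂ) := by
  induction n with
  | zero => simp [poch]
  | succ n ih => rw [poch_succ, ih, Nat.factorial_succ]; push_cast; ring

theorem add_natCast_ne {s : ℂ} (hs : ∀ m : ℕ, s ≠ -(m : ℂ)) (n : ℕ) :
    ∀ m : ℕ, s + n ≠ -(m : ℂ) := fun m h => hs (n + m) (by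
  push_cast; linear_combination h)

theorem Gamma_add_natCast {s : ℂ} (hs : ∀ m : ℕ, s ≠ -(m : ℂ)) (n : ℕ) :
    Gamma (s + n) = poch s n * Gamma s := by
  induction n with
  | zero => simp [poch]
  | succ n ih =>
    have h0 : s + n ≠ 0 := fun h => hs n (eq_neg_of_add_eq_zero_left h)
    rw [Nat.cast_succ, ← add_assoc, Gamma_add_one _ h0, ih, poch_succ]
    ring

/-- The Pochhammer symbol divided by its order of growth `n! (n + 1) ^ (s - 1)`. -/
noncomputable def normalizedPoch (s : ℂ) (n : ℕ) : ℂ :=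
  poch s n / (n.factorial * ((n : ℂ) + 1) ^ (s - 1))

theorem tendsto_inv_GammaSeq (s : ℂ) :
    Filter.Tendsto (fun n => (GammaSeq s n)⁻¹) Filter.atTop (nhds (Gamma s)⁻¹) := by
  by_cases hs : ∀ m : ℕ, s ≠ -(m : ℂ)
  · exact (GammaSeq_tendsto_Gamma s).inv₀ (Gamma_ne_zero hs)
  · push Not at hs
    obtain ⟨m, rfl⟩ := hs
    rw [Gamma_neg_nat_eq_zero, inv_zero]
    refine tendsto_const_nhds.congr' ?_
    filter_upwards [Filter.eventually_ge_atTop m] with n hn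
    have : ∏ j ∈ Finset.range (n + 1), (-(m : ℂ) + j) = 0 :=
      Finset.prod_eq_zero (Finset.mem_range.2 (Nat.lt_succ_of_le hn)) (by simp)
    simp [GammaSeq, this]

theorem tendsto_normalizedPoch (s : ℂ) :
    Filter.Tendsto (normalizedPoch s) Filter.atTop (nhds (Gamma s)⁻¹) := by
  rw [← Filter.tendsto_add_atTop_iff_nat 1]
  have h1 : Filter.Tendsto (fun n : ℕ => (n : ℂ) / (n + 1)) Filter.atTop (nhds 1) :=
    tendsto_natCast_div_add_atTop 1
  have h2 : Filter.Tendsto (fun n : ℕ => ((n : ℂ) / (n + 2)) ^ (s - 1)) Filter.atTop (nhds 1) := by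
    have := (tendsto_natCast_div_add_atTop (𝕜 := ℂ) 2).cpow
      (tendsto_const_nhds (x := s - 1)) (by simp)
    simpa using this
  have h := ((tendsto_inv_GammaSeq s).mul h1).mul h2
  simp only [mul_one] at h
  refine h.congr' ?_
  filter_upwards [Filter.eventually_gt_atTop 0] with n hn
  have hn' : (n : ℂ) ≠ 0 := by exact_mod_cast hn.ne'
  have hn1 : (n : ℂ) + 1 ≠ 0 := by exact_mod_cast n.succ_ne_zero
  have hn2 : (n : ℂ) + 2 ≠ 0 := by exact_mod_cast (n + 1).succ_ne_zero
  have hf : (n.factorial : ℂ) ≠ 0 := by exact_mod_cast n.factorial_ne_zero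
  have e1 : ((n : ℂ) / (n + 2)) ^ (s - 1) = (n : ℂ) ^ (s - 1) / ((n : ℂ) + 2) ^ (s - 1) := by
    have := div_cpow_ofReal_nonneg n.cast_nonneg (n + 2).cast_nonneg (s - 1)
    simpa using this
  have e2 : (n : ℂ) ^ s = (n : ℂ) ^ (s - 1) * n := by
    rw [cpow_sub _ _ hn', cpow_one]; field_simp
  have h3 : (n : ℂ) ^ (s - 1) ≠ 0 := by simp [cpow_eq_zero_iff, hn']
  have h4 : ((n : ℂ) + 2) ^ (s - 1) ≠ 0 := by simp [cpow_eq_zero_iff, hn2]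
  have e3 : ((n + 1 : ℕ) : ℂ) + 1 = n + 2 := by push_cast; ring
  rw [normalizedPoch, e1, GammaSeq, e2, e3, Nat.factorial_succ]
  change (_ / poch s (n + 1))⁻¹ * _ * _ = _
  push_cast
  rw [inv_div]
  field_simp

theorem norm_natCast_add_one_cpow (n : ℕ) (s : ℂ) :
    ‖((n : ℂ) + 1) ^ s‖ = ((n : ℝ) + 1) ^ s.re := by
  have := norm_natCast_cpow_of_pos n.succ_pos s
  simpa using this

theorem norm_poch_eq (s : ℂ) (n : ℕ) :
    ‖poch s n‖ = ‖normalizedPoch s n‖ * (n.factorial * ((n : ℝ) + 1) ^ (s.re - 1)) := by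
  have : (0 : ℝ) < n.factorial * ((n : ℝ) + 1) ^ (s.re - 1) := by positivity
  rw [normalizedPoch, norm_div, norm_mul, norm_natCast_add_one_cpow, norm_natCast, sub_re, one_re,
    div_mul_cancel₀ _ this.ne']

theorem exists_norm_poch_le (s : ℂ) :
    ∃ C > 0, ∀ n : ℕ, ‖poch s n‖ ≤ C * (n.factorial * ((n : ℝ) + 1) ^ (s.re - 1)) := by
  obtain ⟨C, hC0, hC⟩ := (Metric.isBounded_range_of_tendsto _
    (tendsto_normalizedPoch s)).exists_pos_norm_le
  refine ⟨C, hC0, fun n => ?_⟩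
  rw [norm_poch_eq]
  gcongr
  exact hC _ ⟨n, rfl⟩

theorem exists_inv_norm_poch_le {s : ℂ} (hs : ∀ m : ℕ, s ≠ -(m : ℂ)) :
    ∃ C > 0, ∀ n : ℕ, ‖poch s n‖⁻¹ ≤ C * (n.factorial * ((n : ℝ) + 1) ^ (s.re - 1))⁻¹ := by
  obtain ⟨C, hC0, hC⟩ := (Metric.isBounded_range_of_tendsto _
    ((tendsto_normalizedPoch s).inv₀ (inv_ne_zero (Gamma_ne_zero hs)))).exists_pos_norm_le
  refine ⟨C, hC0, fun n => ?_⟩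
  rw [norm_poch_eq, mul_inv, ← norm_inv]
  gcongr
  exact hC _ ⟨n, rfl⟩

theorem exists_norm_poch_succ_le (s : ℂ) :
    ∃ C > 0, ∀ n : ℕ, ‖poch s (n + 1)‖ ≤ C * (n.factorial * ((n : ℝ) + 1) ^ s.re) := by
  obtain ⟨C, hC0, hC⟩ := exists_norm_poch_le (s + 1)
  refine ⟨(‖s‖ + 1) * C, by positivity, fun n => ?_⟩
  have := hC n
  simp only [add_re, one_re, add_sub_cancel_right] at this
  rw [poch_succ', norm_mul, mul_assoc]
  gcongr
  linarith

theorem exists_inv_norm_poch_succ_le {s : ℂ} (hs : ∀ m : ℕ, s ≠ -(m : ℂ)) :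
    ∃ C > 0, ∀ n : ℕ, ‖poch s (n + 1)‖⁻¹ ≤ C * (n.factorial * ((n : ℝ) + 1) ^ s.re)⁻¹ := by
  obtain ⟨C, hC0, hC⟩ := exists_inv_norm_poch_le (s := s + 1) (by simpa using add_natCast_ne hs 1)
  have hs0 : s ≠ 0 := by simpa using hs 0
  refine ⟨‖s‖⁻¹ * C, by positivity, fun n => ?_⟩
  have := hC n
  simp only [add_re, one_re, add_sub_cancel_right] at this
  rw [poch_succ', norm_mul, mul_inv, mul_assoc]
  gcongr

theorem summable_add_one_rpow {p : ℝ} (hp : p < -1) :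
    Summable fun n : ℕ => ((n : ℝ) + 1) ^ p := by
  have := (summable_nat_add_iff 1).2 (Real.summable_nat_rpow.2 hp)
  simpa using this

/-- The `k`-th term of the hypergeometric series `₃F₂(a, b, c; e, f; 1)`. -/
noncomputable def hypTerm (a b c e f : ℂ) (k : ℕ) : ℂ :=
  poch a k * poch b k * poch c k / (poch e k * poch f k * (Nat.factorial k : ℂ))

theorem summable_norm_hypTerm {a b c e f : ℂ} (he : ∀ m : ℕ, e ≠ -(m : ℂ))
    (hf : ∀ m : ℕ, f ≠ -(m : ℂ)) (h : a.re + b.re + c.re < e.re + f.re) :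
    Summable fun k => ‖hypTerm a b c e f k‖ := by
  obtain ⟨A, hA0, hA⟩ := exists_norm_poch_le a
  obtain ⟨B, hB0, hB⟩ := exists_norm_poch_le b
  obtain ⟨C, hC0, hC⟩ := exists_norm_poch_le c
  obtain ⟨E, hE0, hE⟩ := exists_inv_norm_poch_le he
  obtain ⟨F, hF0, hF⟩ := exists_inv_norm_poch_le hf
  have hs := (summable_add_one_rpow
    (p := a.re + b.re + c.re - e.re - f.re - 1) (by linarith)).mul_left (A * B * C * E * F)
  refine hs.of_nonneg_of_le (fun _ => norm_nonneg _) fun k => ?_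
  have hk : (0 : ℝ) < k + 1 := by positivity
  have hkf : (0 : ℝ) < k.factorial := by exact_mod_cast k.factorial_pos
  calc ‖hypTerm a b c e f k‖
      = ‖poch a k‖ * ‖poch b k‖ * ‖poch c k‖ * ‖poch e k‖⁻¹ * ‖poch f k‖⁻¹ *
          (k.factorial : ℝ)⁻¹ := by
        simp only [hypTerm, norm_div, norm_mul, norm_natCast]
        rw [div_eq_mul_inv, mul_inv, mul_inv]; ring
    _ ≤ (A * (k.factorial * ((k : ℝ) + 1) ^ (a.re - 1))) *
          (B * (k.factorial * ((k : ℝ) + 1) ^ (b.re - 1))) *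
          (C * (k.factorial * ((k : ℝ) + 1) ^ (c.re - 1))) *
          (E * (k.factorial * ((k : ℝ) + 1) ^ (e.re - 1))⁻¹) *
          (F * (k.factorial * ((k : ℝ) + 1) ^ (f.re - 1))⁻¹) * (k.factorial : ℝ)⁻¹ := by
        gcongr
        exacts [hA k, hB k, hC k, hE k, hF k]
    _ = _ := by
        have : a.re + b.re + c.re - e.re - f.re - 1 =
          (a.re - 1) + (b.re - 1) + (c.re - 1) - (e.re - 1) - (f.re - 1) := by ring
        simp only [this, Real.rpow_sub hk, Real.rpow_add hk]
        field_simp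

theorem tendsto_hypTerm {a b c e f : ℂ} (he : ∀ m : ℕ, e ≠ -(m : ℂ))
    (hf : ∀ m : ℕ, f ≠ -(m : ℂ)) (h : e + f + 1 = a + b + c) :
    Filter.Tendsto (hypTerm a b c e f) Filter.atTop
      (nhds (Gamma e * Gamma f / (Gamma a * Gamma b * Gamma c))) := by
  have hE := (tendsto_normalizedPoch e).inv₀ (inv_ne_zero (Gamma_ne_zero he))
  have hF := (tendsto_normalizedPoch f).inv₀ (inv_ne_zero (Gamma_ne_zero hf))
  have := ((((tendsto_normalizedPoch a).mul (tendsto_normalizedPoch b)).mul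
    (tendsto_normalizedPoch c)).mul hE).mul hF
  convert this using 1
  · funext k
    have hk : (k : ℂ) + 1 ≠ 0 := by exact_mod_cast k.succ_ne_zero
    have hkf : (k.factorial : ℂ) ≠ 0 := by exact_mod_cast k.factorial_ne_zero
    have hp (s : ℂ) : ((k : ℂ) + 1) ^ s ≠ 0 := by simp [cpow_eq_zero_iff, hk]
    have ha : a - 1 = (e - 1) + (f - 1) - (b - 1) - (c - 1) := by linear_combination -h
    have := poch_ne_zero he k
    have := poch_ne_zero hf k
    have hq : ((k : ℂ) + 1) ^ (a - 1) = ((k : ℂ) + 1) ^ (e - 1) * ((k : ℂ) + 1) ^ (f - 1) /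
        ((k : ℂ) + 1) ^ (b - 1) / ((k : ℂ) + 1) ^ (c - 1) := by
      rw [ha, cpow_sub _ _ hk, cpow_sub _ _ hk, cpow_add _ _ hk]
    have := hp (b - 1)
    have := hp (c - 1)
    have := hp (e - 1)
    have := hp (f - 1)
    simp only [hypTerm, normalizedPoch, hq]
    field_simp
  · simp only [inv_inv, div_eq_mul_inv, mul_inv]
    congr 1; ring

theorem hypTerm_succ_sub {a b c e f : ℂ} (he : ∀ m : ℕ, e ≠ -(m : ℂ))
    (hf : ∀ m : ℕ, f ≠ -(m : ℂ)) (h : e + f = a + b + c + 1) (k : ℕ) :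
    hypTerm a (b + 1) (c + 1) e f (k + 1) - hypTerm a (b + 1) (c + 1) e f k =
      hypTerm a b c e f (k + 1) -
        (e - a) * (f - a) / (e * f) * hypTerm a (b + 1) (c + 1) (e + 1) (f + 1) k := by
  have he0 : e ≠ 0 := by simpa using he 0
  have hf0 : f ≠ 0 := by simpa using hf 0
  have hek : e + k ≠ 0 := fun h => he k (eq_neg_of_add_eq_zero_left h)
  have hfk : f + k ≠ 0 := fun h => hf k (eq_neg_of_add_eq_zero_left h)
  have hpe := poch_ne_zero he k
  have hpf := poch_ne_zero hf k
  have hk : (k : ℂ) + 1 ≠ 0 := by exact_mod_cast k.succ_ne_zero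
  have hkf : (k.factorial : ℂ) ≠ 0 := by exact_mod_cast k.factorial_ne_zero
  have e1 : poch (e + 1) k = poch e k * (e + k) / e := by
    rw [← poch_succ, poch_succ']; field_simp
  have f1 : poch (f + 1) k = poch f k * (f + k) / f := by
    rw [← poch_succ, poch_succ']; field_simp
  have key : (a + k) * (b + 1 + k) * (c + 1 + k) - (e + k) * (f + k) * (k + 1) =
      (a + k) * (b * c) - (e - a) * (f - a) * (k + 1) := by
    linear_combination (-(k : ℂ) - a) * (k + 1) * h
  simp only [hypTerm, e1, f1, poch_succ' b, poch_succ' c, poch_succ a, poch_succ (b + 1),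
    poch_succ (c + 1), poch_succ e, poch_succ f, Nat.factorial_succ]
  push_cast
  field_simp
  linear_combination (poch a k * poch (b + 1) k * poch (c + 1) k) * key

theorem tsum_hypTerm_contiguous {a b c e f : ℂ} (he : ∀ m : ℕ, e ≠ -(m : ℂ))
    (hf : ∀ m : ℕ, f ≠ -(m : ℂ)) (h : e + f = a + b + c + 1) :
    ∑' k, hypTerm a b c e f k = Gamma e * Gamma f / (Gamma a * Gamma (b + 1) * Gamma (c + 1)) +
      (e - a) * (f - a) / (e * f) * ∑' k, hypTerm a (b + 1) (c + 1) (e + 1) (f + 1) k := by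
  have hre : e.re + f.re = a.re + b.re + c.re + 1 := by simpa using congrArg re h
  have s1 : Summable (hypTerm a b c e f) :=
    (summable_norm_hypTerm he hf (by linarith)).of_norm
  have s2 : Summable (hypTerm a (b + 1) (c + 1) (e + 1) (f + 1)) :=
    (summable_norm_hypTerm (by simpa using add_natCast_ne he 1)
      (by simpa using add_natCast_ne hf 1) (by simp; linarith)).of_norm
  have t1 := (((summable_nat_add_iff 1).2 s1).hasSum.sub
    (s2.hasSum.mul_left ((e - a) * (f - a) / (e * f)))).tendsto_sum_nat
  have t2 := (tendsto_hypTerm (a := a) (b := b + 1) (c := c + 1) he hf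
    (by linear_combination h)).sub_const (hypTerm a (b + 1) (c + 1) e f 0)
  have hz (b c : ℂ) : hypTerm a b c e f 0 = 1 := by simp [hypTerm, poch]
  have := tendsto_nhds_unique t1 (t2.congr fun n => by
    rw [← Finset.sum_range_sub]
    exact Finset.sum_congr rfl fun k _ => hypTerm_succ_sub he hf h k)
  rw [s1.tsum_eq_zero_add, hz]
  rw [hz] at this
  linear_combination this

/-- The factor accumulated by `n` applications of `tsum_hypTerm_contiguous`. -/
noncomputable def contiguousFactor (a e f : ℂ) (n : ℕ) : ℂ :=
  poch (e - a) n * poch (f - a) n / (poch e n * poch f n)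

theorem contiguousFactor_mul_hypTerm {a b c e f : ℂ} (hb : ∀ m : ℕ, b + 1 ≠ -(m : ℂ))
    (hc : ∀ m : ℕ, c + 1 ≠ -(m : ℂ)) (n k : ℕ) :
    contiguousFactor a e f (n + 1) *
      hypTerm a (b + (n + 1 : ℕ)) (c + (n + 1 : ℕ)) (e + (n + 1 : ℕ)) (f + (n + 1 : ℕ)) k =
    poch (e - a) (n + 1) * poch (f - a) (n + 1) * poch (b + 1) (n + k) * poch (c + 1) (n + k) *
      poch a k * (poch (b + 1) n)⁻¹ * (poch (c + 1) n)⁻¹ * (poch e (n + k + 1))⁻¹ *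
      (poch f (n + k + 1))⁻¹ * (k.factorial : ℂ)⁻¹ := by
  have hpb := poch_ne_zero hb n
  have hpc := poch_ne_zero hc n
  have hb' : b + (n + 1 : ℕ) = b + 1 + n := by push_cast; ring
  have hc' : c + (n + 1 : ℕ) = c + 1 + n := by push_cast; ring
  rw [hypTerm, contiguousFactor, hb', hc', poch_add (b + 1), poch_add (c + 1),
    add_right_comm n k 1, poch_add e (n + 1), poch_add f (n + 1)]
  field_simp

theorem exists_norm_contiguousFactor_mul_hypTerm_le {a b c e f : ℂ}
    (he : ∀ m : ℕ, e ≠ -(m : ℂ)) (hf : ∀ m : ℕ, f ≠ -(m : ℂ)) (hb : ∀ m : ℕ, b + 1 ≠ -(m : ℂ))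
    (hc : ∀ m : ℕ, c + 1 ≠ -(m : ℂ)) (h : e + f = a + b + c + 1) :
    ∃ C > 0, ∀ n k : ℕ, ‖contiguousFactor a e f (n + 1) *
        hypTerm a (b + (n + 1 : ℕ)) (c + (n + 1 : ℕ)) (e + (n + 1 : ℕ)) (f + (n + 1 : ℕ)) k‖ ≤
      C * (((n : ℝ) + 1) ^ (1 - a.re) * ((n : ℝ) + k + 1) ^ (-a.re - 1) *
        ((k : ℝ) + 1) ^ (a.re - 1)) := by
  have hre : e.re + f.re = a.re + b.re + c.re + 1 := by simpa using congrArg re h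
  obtain ⟨A, hA0, hA⟩ := exists_norm_poch_le a
  obtain ⟨U, hU0, hU⟩ := exists_norm_poch_succ_le (e - a)
  obtain ⟨V, hV0, hV⟩ := exists_norm_poch_succ_le (f - a)
  obtain ⟨B, hB0, hB⟩ := exists_norm_poch_le (b + 1)
  obtain ⟨C, hC0, hC⟩ := exists_norm_poch_le (c + 1)
  obtain ⟨P, hP0, hP⟩ := exists_inv_norm_poch_le hb
  obtain ⟨Q, hQ0, hQ⟩ := exists_inv_norm_poch_le hc
  obtain ⟨E, hE0, hE⟩ := exists_inv_norm_poch_succ_le he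
  obtain ⟨F, hF0, hF⟩ := exists_inv_norm_poch_succ_le hf
  simp only [add_re, one_re, add_sub_cancel_right, sub_re] at hB hC hP hQ hU hV
  refine ⟨U * V * B * C * A * P * Q * E * F, by positivity, fun n k => ?_⟩
  have hx : (0 : ℝ) < n + 1 := by positivity
  have hy : (0 : ℝ) < n + k + 1 := by positivity
  have hkf : (0 : ℝ) < k.factorial := by exact_mod_cast k.factorial_pos
  have hnf : (0 : ℝ) < n.factorial := by exact_mod_cast n.factorial_pos
  have hnkf : (0 : ℝ) < (n + k).factorial := by exact_mod_cast (n + k).factorial_pos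
  have hB := hB (n + k)
  have hC := hC (n + k)
  have hE := hE (n + k)
  have hF := hF (n + k)
  push_cast at hB hC hE hF
  calc _ = ‖poch (e - a) (n + 1)‖ * ‖poch (f - a) (n + 1)‖ * ‖poch (b + 1) (n + k)‖ *
        ‖poch (c + 1) (n + k)‖ * ‖poch a k‖ * ‖poch (b + 1) n‖⁻¹ * ‖poch (c + 1) n‖⁻¹ *
        ‖poch e (n + k + 1)‖⁻¹ * ‖poch f (n + k + 1)‖⁻¹ * (k.factorial : ℝ)⁻¹ := by
        simp only [contiguousFactor_mul_hypTerm hb hc, norm_mul, norm_inv, Complex.norm_natCast]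
    _ ≤ (U * (n.factorial * ((n : ℝ) + 1) ^ (e.re - a.re))) *
          (V * (n.factorial * ((n : ℝ) + 1) ^ (f.re - a.re))) *
          (B * ((n + k).factorial * ((n : ℝ) + k + 1) ^ b.re)) *
          (C * ((n + k).factorial * ((n : ℝ) + k + 1) ^ c.re)) *
          (A * (k.factorial * ((k : ℝ) + 1) ^ (a.re - 1))) *
          (P * (n.factorial * ((n : ℝ) + 1) ^ b.re)⁻¹) *
          (Q * (n.factorial * ((n : ℝ) + 1) ^ c.re)⁻¹) *
          (E * ((n + k).factorial * ((n : ℝ) + k + 1) ^ e.re)⁻¹) *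
          (F * ((n + k).factorial * ((n : ℝ) + k + 1) ^ f.re)⁻¹) * (k.factorial : ℝ)⁻¹ := by
        gcongr
        exacts [hU n, hV n, hA k, hP n, hQ n]
    _ = _ := by
        have e1 : 1 - a.re = (e.re - a.re) + (f.re - a.re) - b.re - c.re := by linarith
        have e2 : -a.re - 1 = b.re + c.re - e.re - f.re := by linarith
        have hx' (p : ℝ) := (Real.rpow_pos_of_pos hx p).ne'
        have hy' (p : ℝ) := (Real.rpow_pos_of_pos hy p).ne'
        have hxa := hx' a.re
        have hxb := hx' b.re
        have hxc := hx' c.re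
        have hye := hy' e.re
        have hyf := hy' f.re
        rw [e1, e2, Real.rpow_sub hx (_ - _), Real.rpow_sub hx (_ + _), Real.rpow_add hx,
          Real.rpow_sub hx, Real.rpow_sub hx, Real.rpow_sub hy, Real.rpow_sub hy, Real.rpow_add hy]
        field_simp

theorem tendsto_contiguousFactor_mul_tsum {a b c e f : ℂ} (ha : 0 < a.re)
    (he : ∀ m : ℕ, e ≠ -(m : ℂ)) (hf : ∀ m : ℕ, f ≠ -(m : ℂ)) (hb : ∀ m : ℕ, b + 1 ≠ -(m : ℂ))
    (hc : ∀ m : ℕ, c + 1 ≠ -(m : ℂ)) (h : e + f = a + b + c + 1) :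
    Filter.Tendsto (fun n : ℕ => contiguousFactor a e f n *
      ∑' k, hypTerm a (b + n) (c + n) (e + n) (f + n) k) Filter.atTop (nhds 0) := by
  obtain ⟨C, hC0, hC⟩ := exists_norm_contiguousFactor_mul_hypTerm_le he hf hb hc h
  rw [← Filter.tendsto_add_atTop_iff_nat 1]
  simp only [← tsum_mul_left]
  have hδ : 0 < min a.re 1 := lt_min ha one_pos
  rw [← tsum_zero (α := ℂ) (β := ℕ)]
  refine tendsto_tsum_of_dominated_convergence
    (bound := fun k : ℕ => C * ((k : ℝ) + 1) ^ (-1 - min a.re 1))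
    ((summable_add_one_rpow (by linarith)).mul_left C) (fun k => ?_) (.of_forall fun n k => ?_)
  · have hlim : Filter.Tendsto (fun n : ℕ => C * (((n : ℝ) + 1) ^ (-(2 * a.re)) *
        ((k : ℝ) + 1) ^ (a.re - 1))) Filter.atTop (nhds 0) := by
      have h1 : Filter.Tendsto (fun n : ℕ => (n : ℝ) + 1) Filter.atTop Filter.atTop :=
        Filter.tendsto_atTop_add_const_right _ _ tendsto_natCast_atTop_atTop
      simpa using (((tendsto_rpow_neg_atTop (by linarith : 0 < 2 * a.re)).comp h1).mul_const
        (((k : ℝ) + 1) ^ (a.re - 1))).const_mul C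
    refine squeeze_zero_norm (fun n => (hC n k).trans ?_) hlim
    have hx : (0 : ℝ) < n + 1 := by positivity
    have e1 : -(2 * a.re) = (1 - a.re) + (-a.re - 1) := by ring
    rw [e1, Real.rpow_add hx]
    have hk : (0 : ℝ) ≤ k := k.cast_nonneg
    have hle : ((n : ℝ) + k + 1) ^ (-a.re - 1) ≤ ((n : ℝ) + 1) ^ (-a.re - 1) :=
      Real.rpow_le_rpow_of_nonpos hx (by linarith) (by linarith)
    gcongr ?_ * (?_ * ?_ * ?_)
  · refine (hC n k).trans ?_
    have hx : (0 : ℝ) < n + 1 := by positivity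
    have hy : (0 : ℝ) < n + k + 1 := by positivity
    have hz : (0 : ℝ) < k + 1 := by positivity
    have hn : (0 : ℝ) ≤ n := n.cast_nonneg
    have hk : (0 : ℝ) ≤ k := k.cast_nonneg
    have h1 : ((n : ℝ) + 1) ^ (1 - a.re) ≤ ((n : ℝ) + k + 1) ^ (1 - min a.re 1) :=
      calc ((n : ℝ) + 1) ^ (1 - a.re) ≤ ((n : ℝ) + 1) ^ (1 - min a.re 1) :=
            Real.rpow_le_rpow_of_exponent_le (by linarith) (by linarith [min_le_left a.re 1])
        _ ≤ _ := Real.rpow_le_rpow hx.le (by linarith) (by linarith [min_le_right a.re 1])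
    gcongr
    calc _ ≤ ((n : ℝ) + k + 1) ^ (1 - min a.re 1) * ((n : ℝ) + k + 1) ^ (-a.re - 1) *
          ((k : ℝ) + 1) ^ (a.re - 1) := by gcongr
      _ = ((n : ℝ) + k + 1) ^ (-a.re - min a.re 1) * ((k : ℝ) + 1) ^ (a.re - 1) := by
          rw [← Real.rpow_add hy]; ring_nf
      _ ≤ ((k : ℝ) + 1) ^ (-a.re - min a.re 1) * ((k : ℝ) + 1) ^ (a.re - 1) := by
          refine mul_le_mul_of_nonneg_right ?_ (by positivity)
          exact Real.rpow_le_rpow_of_nonpos hz (by linarith) (by linarith)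
      _ = _ := by rw [← Real.rpow_add hz]; ring_nf

theorem contiguousFactor_mul_tsum_sub {a b c e f : ℂ} (ha : 0 < a.re)
    (he : ∀ m : ℕ, e ≠ -(m : ℂ)) (hf : ∀ m : ℕ, f ≠ -(m : ℂ)) (hb : ∀ m : ℕ, b + 1 ≠ -(m : ℂ))
    (hc : ∀ m : ℕ, c + 1 ≠ -(m : ℂ)) (h : e + f = a + b + c + 1) (n : ℕ) :
    contiguousFactor a e f n * ∑' k, hypTerm a (b + n) (c + n) (e + n) (f + n) k -
      contiguousFactor a e f (n + 1) * ∑' k, hypTerm a (b + (n + 1 : ℕ)) (c + (n + 1 : ℕ))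
        (e + (n + 1 : ℕ)) (f + (n + 1 : ℕ)) k =
    Gamma e * Gamma f / (Gamma a * Gamma (b + 1) * Gamma (c + 1)) *
      hypTerm (e - a) (f - a) 1 (b + 1) (c + 1) n := by
  have hen : e + n ≠ 0 := fun h => he n (eq_neg_of_add_eq_zero_left h)
  have hfn : f + n ≠ 0 := fun h => hf n (eq_neg_of_add_eq_zero_left h)
  have hpe := poch_ne_zero he n
  have hpf := poch_ne_zero hf n
  have hpb := poch_ne_zero hb n
  have hpc := poch_ne_zero hc n
  have hGb := Gamma_ne_zero hb
  have hGc := Gamma_ne_zero hc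
  have hGa := Gamma_ne_zero_of_re_pos ha
  have hnf : (n.factorial : ℂ) ≠ 0 := by exact_mod_cast n.factorial_ne_zero
  rw [tsum_hypTerm_contiguous (add_natCast_ne he n) (add_natCast_ne hf n)
    (by linear_combination h)]
  simp only [Nat.cast_succ, ← add_assoc]
  rw [Gamma_add_natCast he, Gamma_add_natCast hf, add_right_comm b, add_right_comm c,
    Gamma_add_natCast hb, Gamma_add_natCast hc]
  generalize ∑' k, hypTerm a _ _ _ _ k = L
  simp only [contiguousFactor, hypTerm, poch_succ, poch_one]
  field_simp
  ring

theorem tsum_hypTerm_saalschutzian {a b c e f : ℂ} (ha : 0 < a.re)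
    (he : ∀ m : ℕ, e ≠ -(m : ℂ)) (hf : ∀ m : ℕ, f ≠ -(m : ℂ)) (hb : ∀ m : ℕ, b + 1 ≠ -(m : ℂ))
    (hc : ∀ m : ℕ, c + 1 ≠ -(m : ℂ)) (h : e + f = a + b + c + 1)
    (hs : Summable (hypTerm (e - a) (f - a) 1 (b + 1) (c + 1))) :
    ∑' k, hypTerm a b c e f k = Gamma e * Gamma f / (Gamma a * Gamma (b + 1) * Gamma (c + 1)) *
      ∑' k, hypTerm (e - a) (f - a) 1 (b + 1) (c + 1) k := by
  have t1 := (hs.hasSum.mul_left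
    (Gamma e * Gamma f / (Gamma a * Gamma (b + 1) * Gamma (c + 1)))).tendsto_sum_nat
  simp only [← contiguousFactor_mul_tsum_sub ha he hf hb hc h] at t1
  have t2 := (tendsto_contiguousFactor_mul_tsum ha he hf hb hc h).const_sub
    (∑' k, hypTerm a b c e f k)
  rw [sub_zero] at t2
  refine tendsto_nhds_unique (t2.congr fun n => ?_) t1
  rw [Finset.sum_range_sub' (fun n : ℕ => contiguousFactor a e f n *
    ∑' k, hypTerm a (b + n) (c + n) (e + n) (f + n) k)]
  simp [contiguousFactor, poch]

/-- Transformation of a nonterminating Saalschützian ₃F₂(1) into a ₃F₂(1) with an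
upper parameter 1. -/
theorem saalschutzian_to_upper_one (a b c e : ℂ) (ha : 0 < a.re)
    (he : ∀ m : ℕ, e ≠ -(m : ℂ))
    (h1 : ∀ m : ℕ, a + b + c - e + 1 ≠ -(m : ℂ))
    (h2 : ∀ m : ℕ, b + 1 ≠ -(m : ℂ))
    (h3 : ∀ m : ℕ, c + 1 ≠ -(m : ℂ)) :
    (Summable fun k : ℕ =>
      ‖poch a k * poch b k * poch c k /
        (poch e k * poch (a + b + c - e + 1) k * (Nat.factorial k : ℂ))‖) ∧
    (Summable fun k : ℕ =>
      ‖poch (e - a) k * poch (b + c - e + 1) k * poch 1 k /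
        (poch (b + 1) k * poch (c + 1) k * (Nat.factorial k : ℂ))‖) ∧
    ∑' k : ℕ, poch a k * poch b k * poch c k /
        (poch e k * poch (a + b + c - e + 1) k * (Nat.factorial k : ℂ)) =
      Complex.Gamma e * Complex.Gamma (a + b + c - e + 1) /
        (Complex.Gamma a * Complex.Gamma (b + 1) * Complex.Gamma (c + 1)) *
      ∑' k : ℕ, poch (e - a) k * poch (b + c - e + 1) k * poch 1 k /
        (poch (b + 1) k * poch (c + 1) k * (Nat.factorial k : ℂ)) := by
  have h : e + (a + b + c - e + 1) = a + b + c + 1 := by ring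
  have hfa : a + b + c - e + 1 - a = b + c - e + 1 := by ring
  have s1 := summable_norm_hypTerm (a := a) (b := b) (c := c) he h1 (by simp; linarith)
  have s2 := summable_norm_hypTerm (a := e - a) (b := b + c - e + 1) (c := 1) h2 h3
    (by simp; linarith)
  have key := tsum_hypTerm_saalschutzian ha he h1 h2 h3 h (by rw [hfa]; exact s2.of_norm)
  rw [hfa] at key
  exact ⟨s1, s2, key⟩
end

section
/- Riemann-sum asymptotics for a sum of Gamma quotients: let a, b, d, e ∈ ℂ with Re(a−e+1) > 0 and Re(d+e−a−b−1) > 0, and assume none of a, b, d, e, d−a, d−b, b−e+1 is a nonpositive integer. Then lim_{n→∞} [Γ(d−a+n) / Γ(b−e+1+n)] · ∑_{k=0}^∞ [Γ(a+k) / Γ(e+k)] · [Γ(b+n+k) / Γ(d+n+k)] = Γ(a−e+1) Γ(d+e−a−b−1) / Γ(d−b), where for each n the series converges absolutely. -/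
open Complex Filter

section

open Asymptotics Topology Set MeasureTheory

lemma Gamma_add_natCast_isEquivalent_of_re_pos {z : ℂ} (hz : 0 < z.re) :
    (fun n : ℕ => Gamma (z + n)) ~[atTop] fun n : ℕ => Gamma n * (n : ℂ) ^ z := by
  have hzm : ∀ m : ℕ, z ≠ -m := by
    rintro m rfl
    simp at hz
    linarith [(Nat.cast_nonneg m : (0 : ℝ) ≤ m)]
  have hΓ := Gamma_ne_zero hzm
  have hadd : ∀ n : ℕ, z + n ≠ 0 := fun n h => hzm n (eq_neg_of_add_eq_zero_left h)
  have hprod : ∀ n : ℕ, Gamma (z + n) = Gamma z * ∏ j ∈ Finset.range n, (z + j) := by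
    intro n
    induction n with
    | zero => simp
    | succ n ih =>
      rw [Finset.prod_range_succ, ← mul_assoc, ← ih, mul_comm, ← Gamma_add_one _ (hadd n)]
      push_cast
      ring_nf
  have h1 : Tendsto (fun n : ℕ => Gamma z / GammaSeq z n) atTop (𝓝 1) := by
    have := (tendsto_const_nhds (x := Gamma z)).div (GammaSeq_tendsto_Gamma z) hΓ
    rwa [div_self hΓ] at this
  have h2 : Tendsto (fun n : ℕ => (n : ℂ) / (n + z)) atTop (𝓝 1) :=
    tendsto_natCast_div_add_atTop z
  have hev : ∀ᶠ n : ℕ in atTop, Gamma n * (n : ℂ) ^ z ≠ 0 := by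
    filter_upwards [eventually_gt_atTop 0] with n hn
    have hn' : (n : ℂ) ≠ 0 := by exact_mod_cast hn.ne'
    refine mul_ne_zero (Gamma_ne_zero_of_re_pos (by simpa using hn)) ?_
    simp [cpow_eq_zero_iff, hn']
  rw [isEquivalent_iff_tendsto_one hev]
  have h12 := h1.mul h2
  rw [mul_one] at h12
  refine h12.congr' ?_
  filter_upwards [eventually_gt_atTop 0] with n hn
  have hn' : (n : ℂ) ≠ 0 := by exact_mod_cast hn.ne'
  have hnz : (n : ℂ) ^ z ≠ 0 := by simp [cpow_eq_zero_iff, hn']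
  have hfac : (n.factorial : ℂ) = n * Gamma n := by
    rw [← Gamma_nat_eq_factorial, Gamma_add_one _ hn']
  have hΓ' : Gamma (n : ℂ) ≠ 0 := Gamma_ne_zero_of_re_pos (by simpa using hn)
  have ha := hadd n
  have ha' : (n : ℂ) + z ≠ 0 := by rwa [add_comm]
  simp only [GammaSeq, Pi.div_apply]
  rw [hprod n, Finset.prod_range_succ, hfac]
  field_simp
  ring

/-- `Γ(z + n) ~ Γ(n) n ^ z` as the natural number `n` tends to infinity. -/
lemma Gamma_add_natCast_isEquivalent (z : ℂ) :
    (fun n : ℕ => Gamma (z + n)) ~[atTop] fun n : ℕ => Gamma n * (n : ℂ) ^ z := by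
  suffices H : ∀ m : ℕ, ∀ z : ℂ, 0 < z.re + m →
      (fun n : ℕ => Gamma (z + n)) ~[atTop] fun n : ℕ => Gamma n * (n : ℂ) ^ z by
    obtain ⟨m, hm⟩ := exists_nat_gt (-z.re)
    exact H m z (by linarith)
  intro m
  induction m with
  | zero => exact fun z hz => Gamma_add_natCast_isEquivalent_of_re_pos (by simpa using hz)
  | succ m ih =>
    intro z hz
    have h1 := ih (z + 1) (by push_cast at hz; simp; linarith)
    have h2 : (fun n : ℕ => (n : ℂ) + z) ~[atTop] fun n : ℕ => (n : ℂ) := by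
      refine IsEquivalent.symm ((isEquivalent_iff_tendsto_one ?_).2
        (tendsto_natCast_div_add_atTop z))
      filter_upwards [eventually_gt_atTop ⌈-z.re⌉₊] with n hn h0
      have := Nat.lt_of_ceil_lt hn
      have h3 := congrArg re h0
      simp at h3
      linarith
    refine (h1.div h2).congr_left ?_ |>.congr_right ?_
    · filter_upwards [eventually_gt_atTop ⌈-z.re⌉₊] with n hn
      have := Nat.lt_of_ceil_lt hn
      have h0 : z + n ≠ 0 := fun h0 => by
        have h3 := congrArg re h0
        simp at h3
        linarith
      simp only [Pi.div_apply]
      rw [show z + 1 + n = z + n + 1 by ring, Gamma_add_one _ h0, add_comm (n : ℂ) z,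
        mul_div_cancel_left₀ _ h0]
    · filter_upwards [eventually_gt_atTop 0] with n hn
      have hn' : (n : ℂ) ≠ 0 := by exact_mod_cast hn.ne'
      simp only [Pi.div_apply]
      rw [cpow_add _ _ hn', cpow_one]
      field_simp

lemma Gamma_add_natCast_div_isEquivalent (z w : ℂ) :
    (fun n : ℕ => Gamma (z + n) / Gamma (w + n)) ~[atTop] fun n : ℕ => (n : ℂ) ^ (z - w) := by
  refine ((Gamma_add_natCast_isEquivalent z).div
    (Gamma_add_natCast_isEquivalent w)).congr_right ?_
  filter_upwards [eventually_gt_atTop 0] with n hn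
  have hn' : (n : ℂ) ≠ 0 := by exact_mod_cast hn.ne'
  have hΓ' : Gamma (n : ℂ) ≠ 0 := Gamma_ne_zero_of_re_pos (by simpa using hn)
  simp only [Pi.div_apply]
  rw [cpow_sub _ _ hn', mul_div_mul_left _ _ hΓ']

lemma natCast_cpow_isBigO_of_re_le {s t : ℂ} (h : s.re ≤ t.re) :
    (fun n : ℕ => (n : ℂ) ^ s) =O[atTop] fun n : ℕ => (n : ℂ) ^ t := by
  refine IsBigO.of_bound 1 ?_
  filter_upwards [eventually_gt_atTop 0] with n hn
  rw [norm_natCast_cpow_of_pos hn, norm_natCast_cpow_of_pos hn, one_mul]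
  exact Real.rpow_le_rpow_of_exponent_le (by exact_mod_cast hn) h

/-- Quotients of Gamma values with the same growth exponent are comparable. -/
lemma exists_norm_Gamma_div_le {z w x y : ℂ} (hx : 0 < x.re) (hy : 0 < y.re)
    (h : (z - w).re = (x - y).re) :
    ∃ C > 0, ∀ n : ℕ, ‖Gamma (z + n) / Gamma (w + n)‖ ≤ C * ‖Gamma (x + n) / Gamma (y + n)‖ := by
  have hO := (Gamma_add_natCast_div_isEquivalent z w).isBigO.trans
    ((natCast_cpow_isBigO_of_re_le h.le).trans
      (Gamma_add_natCast_div_isEquivalent x y).symm.isBigO)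
  obtain ⟨C, hC, hb⟩ := bound_of_isBigO_nat_atTop hO
  refine ⟨C, hC, fun n => hb (div_ne_zero ?_ ?_)⟩ <;>
    exact Gamma_ne_zero_of_re_pos (by simp; positivity)

lemma summable_norm_Gamma_div_mul_Gamma_div {z w x y : ℂ} (h : (z - w + (x - y)).re < -1) :
    Summable fun k : ℕ =>
      ‖Gamma (z + k) / Gamma (w + k) * (Gamma (x + k) / Gamma (y + k))‖ := by
  have hO := ((Gamma_add_natCast_div_isEquivalent z w).mul
    (Gamma_add_natCast_div_isEquivalent x y)).isBigO.norm_norm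
  refine summable_of_isBigO_nat (Real.summable_nat_rpow.2 h) (hO.trans_eventuallyEq ?_)
  filter_upwards [eventually_gt_atTop 0] with n hn
  have hn' : (n : ℂ) ≠ 0 := by exact_mod_cast hn.ne'
  rw [Pi.mul_apply, ← cpow_add _ _ hn', norm_natCast_cpow_of_pos hn]

lemma hasSum_Gamma_div_mul_pow {u x : ℂ} (hu : 0 < u.re) (hx : ‖x‖ < 1) :
    HasSum (fun k : ℕ => Gamma (u + k) / Gamma (1 + k) * x ^ k) (Gamma u / (1 - x) ^ u) := by
  have hum : ∀ m : ℕ, u ≠ -m := by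
    rintro m rfl
    simp at hu
    linarith [(Nat.cast_nonneg m : (0 : ℝ) ≤ m)]
  have hΓ := Gamma_ne_zero hum
  have h := (one_div_one_sub_cpow_hasFPowerSeriesOnBall_zero u).hasSum (y := x) (by
    simpa [← ofReal_norm] using hx)
  have h := h.mul_left (Gamma u)
  rw [zero_add, mul_one_div] at h
  refine h.congr_fun ?_
  intro k
  have hk : Gamma (1 + k : ℂ) = k.factorial := by rw [add_comm, Gamma_nat_eq_factorial]
  have hf : (k.factorial : ℂ) ≠ 0 := by exact_mod_cast k.factorial_ne_zero
  have h3 := Gamma_add_nat_div_Gamma_eq (n := k) u hum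
  have h4 := Ring.factorial_nsmul_multichoose_eq_ascPochhammer u k
  rw [Ring.multichoose_eq, Polynomial.ascPochhammer_smeval_eq_eval, ← h3, nsmul_eq_mul] at h4
  rw [hk]
  simp [FormalMultilinearSeries.ofScalars]
  field_simp at h4 ⊢
  rw [← h4]

lemma integrableOn_betaIntegrand {p r : ℂ} (hp : 0 < p.re) (hr : 0 < r.re) :
    IntegrableOn (fun t : ℝ => (t : ℂ) ^ (p - 1) * (1 - (t : ℂ)) ^ (r - 1)) (Ioo 0 1) :=
  (betaIntegral_convergent hp hr).1.mono_set Ioo_subset_Ioc_self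

lemma setIntegral_Ioo_eq_betaIntegral (p r : ℂ) :
    ∫ t : ℝ in Ioo 0 1, (t : ℂ) ^ (p - 1) * (1 - (t : ℂ)) ^ (r - 1) = betaIntegral p r := by
  rw [betaIntegral, intervalIntegral.integral_of_le zero_le_one, integral_Ioc_eq_integral_Ioo]

lemma setIntegral_norm_betaIntegrand (p r : ℂ) :
    ((∫ t : ℝ in Ioo 0 1, ‖(t : ℂ) ^ (p - 1) * (1 - (t : ℂ)) ^ (r - 1)‖ : ℝ) : ℂ) =
      betaIntegral p.re r.re := by
  rw [← setIntegral_Ioo_eq_betaIntegral, ← integral_complex_ofReal]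
  refine setIntegral_congr_fun measurableSet_Ioo fun t ht => ?_
  have h1 : 0 < 1 - t := sub_pos.2 ht.2
  have h2 : (1 - (t : ℂ)) = ((1 - t : ℝ) : ℂ) := by push_cast; rfl
  simp only [h2]
  rw [norm_mul, norm_cpow_eq_rpow_re_of_pos ht.1, norm_cpow_eq_rpow_re_of_pos h1, ofReal_mul,
    ofReal_cpow ht.1.le, ofReal_cpow h1.le]
  simp

/-- **Gauss's summation theorem** for `₂F₁` at `1`, in terms of Gamma quotients. -/
lemma hasSum_Gamma_div_mul_Gamma_div {u v q : ℂ} (hu : 0 < u.re) (hv : 0 < v.re)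
    (hq : 0 < q.re) :
    HasSum (fun k : ℕ => Gamma (u + k) / Gamma (1 + k) * (Gamma (q + k) / Gamma (q + u + v + k)))
      (Gamma u * Gamma v / Gamma (u + v) * (Gamma q / Gamma (q + v))) := by
  have huv : 0 < (u + v).re := by simp; linarith
  have hqk : ∀ k : ℕ, 0 < (q + k).re := fun k => by simp; positivity
  have hΓ : Gamma (u + v) ≠ 0 := Gamma_ne_zero_of_re_pos huv
  let F : ℕ → ℝ → ℂ := fun k t =>
    Gamma (u + k) / Gamma (1 + k) * ((t : ℂ) ^ (q + k - 1) * (1 - (t : ℂ)) ^ (u + v - 1))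
  have hint : ∀ k, Integrable (F k) (volume.restrict (Ioo 0 1)) := fun k =>
    (integrableOn_betaIntegrand (hqk k) huv).const_mul _
  have hnorm : ∀ k, ∫ t in Ioo 0 1, ‖F k t‖ =
      ‖Gamma (u + k) / Gamma (1 + k) *
        (Gamma (q.re + k) / Gamma (q.re + (u + v).re + k))‖ * ‖Gamma (u + v).re‖ := by
    intro k
    have h0 := setIntegral_norm_betaIntegrand (q + k) (u + v)
    rw [betaIntegral_eq_Gamma_mul_div _ _ (by simpa using hqk k) (by simpa using huv)] at h0
    have h1 := congrArg norm h0
    rw [norm_real, Real.norm_of_nonneg (integral_nonneg fun _ => norm_nonneg _)] at h1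
    simp only [F, norm_mul (Gamma (u + k) / Gamma (1 + k))]
    rw [integral_const_mul, h1, ← norm_mul, ← norm_mul, ← norm_mul]
    congr 1
    simp only [add_re, natCast_re, ofReal_add, ofReal_natCast]
    ring_nf
  have hsum : Summable fun k => ∫ t in Ioo 0 1, ‖F k t‖ := by
    simp only [hnorm]
    refine Summable.mul_right _ (summable_norm_Gamma_div_mul_Gamma_div ?_)
    simp
    linarith
  have H := hasSum_integral_of_summable_integral_norm hint hsum
  have hval : ∫ t in Ioo 0 1, (∑' k, F k t) = Gamma u * betaIntegral q v := by
    rw [← setIntegral_Ioo_eq_betaIntegral, ← integral_const_mul]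
    refine setIntegral_congr_fun measurableSet_Ioo fun t ht => ?_
    have ht0 : (t : ℂ) ≠ 0 := by exact_mod_cast ht.1.ne'
    have ht1 : 1 - (t : ℂ) ≠ 0 := by exact_mod_cast (sub_pos.2 ht.2).ne'
    have hs := (hasSum_Gamma_div_mul_pow hu (x := (t : ℂ)) (by
      rw [norm_real, Real.norm_of_nonneg ht.1.le]; exact ht.2)).mul_right
      ((t : ℂ) ^ (q - 1) * (1 - (t : ℂ)) ^ (u + v - 1))
    have hF : ∀ k, F k t = Gamma (u + k) / Gamma (1 + k) * (t : ℂ) ^ k *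
        ((t : ℂ) ^ (q - 1) * (1 - (t : ℂ)) ^ (u + v - 1)) := by
      intro k
      simp only [F]
      rw [show q + k - 1 = q - 1 + k by ring, cpow_add _ _ ht0, cpow_natCast]
      ring
    simp only [hF]
    rw [hs.tsum_eq, show u + v - 1 = u + (v - 1) by ring, cpow_add _ _ ht1]
    have : (1 - (t : ℂ)) ^ u ≠ 0 := by simp [cpow_eq_zero_iff, ht1]
    field_simp
  rw [hval, betaIntegral_eq_Gamma_mul_div _ _ hq hv] at H
  have H' := H.mul_right (Gamma (u + v))⁻¹
  have hlim : Gamma u * Gamma v / Gamma (u + v) * (Gamma q / Gamma (q + v)) =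
      Gamma u * (Gamma q * Gamma v / Gamma (q + v)) * (Gamma (u + v))⁻¹ := by ring
  rw [hlim]
  refine H'.congr_fun fun k => ?_
  simp only [F]
  rw [integral_const_mul, setIntegral_Ioo_eq_betaIntegral,
    betaIntegral_eq_Gamma_mul_div _ _ (hqk k) huv,
    show q + k + (u + v) = q + u + v + k by ring]
  field_simp

/-- A Toeplitz-type lemma: weighted sums of a null sequence tend to zero when the weights have
bounded total mass and tend to zero termwise. -/
lemma tendsto_tsum_mul_of_tendsto_zero {c : ℕ → ℂ} {w : ℕ → ℕ → ℂ} {M : ℝ}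
    (hc : Tendsto c atTop (𝓝 0)) (hw : ∀ k, Tendsto (fun n => w n k) atTop (𝓝 0))
    (hs : ∀ n, Summable fun k => ‖w n k‖) (hM : ∀ n, ∑' k, ‖w n k‖ ≤ M) :
    Tendsto (fun n => ∑' k, c k * w n k) atTop (𝓝 0) := by
  obtain ⟨B, hB⟩ := (Metric.isBounded_range_of_tendsto c hc).exists_norm_le
  have hB' : ∀ k, ‖c k‖ ≤ B := fun k => hB _ (mem_range_self k)
  have hM0 : 0 ≤ M := (tsum_nonneg fun _ => norm_nonneg _).trans (hM 0)
  have hsc : ∀ n, Summable fun k => ‖c k * w n k‖ := fun n =>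
    Summable.of_nonneg_of_le (fun _ => norm_nonneg _) (fun k => by
      rw [norm_mul]; exact mul_le_mul_of_nonneg_right (hB' k) (norm_nonneg _)) ((hs n).mul_left B)
  rw [Metric.tendsto_atTop']
  intro ε hε
  have hδ : 0 < ε / (2 * (M + 1)) := by positivity
  obtain ⟨K, hK⟩ := eventually_atTop.1 ((tendsto_zero_iff_norm_tendsto_zero.1 hc).eventually
    (gt_mem_nhds hδ))
  have hfin : Tendsto (fun n => ∑ k ∈ Finset.range K, ‖c k * w n k‖) atTop (𝓝 0) := by
    have := tendsto_finsetSum (Finset.range K) fun k _ => ((hw k).const_mul (c k)).norm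
    simpa using this
  obtain ⟨N, hN⟩ := eventually_atTop.1 (hfin.eventually (gt_mem_nhds (half_pos hε)))
  refine ⟨N, fun n hn => ?_⟩
  rw [dist_zero_right]
  have htail : ∑' k, ‖c (k + K) * w n (k + K)‖ ≤ ε / (2 * (M + 1)) * M := by
    have hsK := (summable_nat_add_iff K).2 (hs n)
    calc ∑' k, ‖c (k + K) * w n (k + K)‖
        ≤ ∑' k, ε / (2 * (M + 1)) * ‖w n (k + K)‖ := by
          refine ((summable_nat_add_iff K).2 (hsc n)).tsum_le_tsum (fun k => ?_)
            (hsK.mul_left _)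
          rw [norm_mul]
          exact mul_le_mul_of_nonneg_right (hK _ (Nat.le_add_left _ _)).le (norm_nonneg _)
      _ = ε / (2 * (M + 1)) * ∑' k, ‖w n (k + K)‖ := tsum_mul_left
      _ ≤ ε / (2 * (M + 1)) * M := by
          refine mul_le_mul_of_nonneg_left (le_trans ?_ (hM n)) hδ.le
          rw [← (hs n).sum_add_tsum_nat_add K]
          exact le_add_of_nonneg_left (Finset.sum_nonneg fun _ _ => norm_nonneg _)
  have hlt : ε / (2 * (M + 1)) * M < ε / 2 := by
    rw [div_mul_eq_mul_div, div_lt_div_iff₀ (by positivity) two_pos]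
    nlinarith
  calc ‖∑' k, c k * w n k‖ ≤ ∑' k, ‖c k * w n k‖ := norm_tsum_le_tsum_norm (hsc n)
    _ = ∑ k ∈ Finset.range K, ‖c k * w n k‖ + ∑' k, ‖c (k + K) * w n (k + K)‖ :=
        ((hsc n).sum_add_tsum_nat_add K).symm
    _ < ε := by linarith [hN n hn.le]

lemma ofReal_norm_Gamma_div {x y : ℝ} (hx : 0 < x) (hy : 0 < y) :
    ((‖Gamma x / Gamma y‖ : ℝ) : ℂ) = Gamma x / Gamma y := by
  rw [Gamma_ofReal, Gamma_ofReal, ← ofReal_div, norm_real,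
    Real.norm_of_nonneg (div_nonneg (Real.Gamma_pos_of_pos hx).le (Real.Gamma_pos_of_pos hy).le)]

lemma tsum_norm_Gamma_div_mul_Gamma_div {u v q : ℝ} (hu : 0 < u) (hv : 0 < v) (hq : 0 < q) :
    ∑' k : ℕ, ‖Gamma (u + k) / Gamma (1 + k) * (Gamma (q + k) / Gamma (q + u + v + k))‖ =
      ‖(Gamma u * Gamma v / Gamma (u + v) * (Gamma q / Gamma (q + v)) : ℂ)‖ := by
  have H := (hasSum_Gamma_div_mul_Gamma_div (u := u) (v := v) (q := q) (by simpa) (by simpa)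
    (by simpa)).tsum_eq
  rw [← H, ← abs_of_nonneg (tsum_nonneg fun _ => norm_nonneg _), ← Real.norm_eq_abs, ← norm_real,
    ofReal_tsum]
  congr 1
  refine tsum_congr fun k => ?_
  have h1 := ofReal_norm_Gamma_div (x := u + k) (y := 1 + k) (by positivity) (by positivity)
  have h2 := ofReal_norm_Gamma_div (x := q + k) (y := q + u + v + k) (by positivity)
    (by positivity)
  push_cast at h1 h2
  rw [norm_mul, ofReal_mul, h1, h2]

/-- The normalized comparison series have uniformly bounded absolute sums. -/
lemma exists_tsum_norm_le {b d x y u v : ℂ} (hu : 0 < u.re) (hv : 0 < v.re)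
    (hbd : d - b = u + v) (hxy : x - y = v) :
    ∃ M, ∀ n : ℕ, ∑' k : ℕ, ‖Gamma (x + n) / Gamma (y + n) * (Gamma (u + k) / Gamma (1 + k) *
      (Gamma (b + n + k) / Gamma (d + n + k)))‖ ≤ M := by
  obtain ⟨C₁, hC₁, h₁⟩ := exists_norm_Gamma_div_le (z := u) (w := 1) (x := u.re) (y := 1)
    (by simpa) (by simp) (by simp)
  obtain ⟨C₂, hC₂, h₂⟩ := exists_norm_Gamma_div_le (z := b) (w := d) (x := 1)
    (y := 1 + u.re + v.re) (by simp) (by simp; linarith) (by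
      rw [← neg_sub, hbd]; simp; ring)
  obtain ⟨C₃, hC₃, h₃⟩ := exists_norm_Gamma_div_le (z := x) (w := y) (x := 1 + v.re) (y := 1)
    (by simp; linarith) (by simp) (by simp [hxy])
  have hsum : ∀ n : ℕ, Summable fun k : ℕ => ‖Gamma (u.re + k) / Gamma (1 + k) *
      (Gamma (((1 + n : ℝ) : ℂ) + k) / Gamma (((1 + n : ℝ) : ℂ) + u.re + v.re + k))‖ := fun n =>
    summable_norm_Gamma_div_mul_Gamma_div (by simp; linarith)
  refine ⟨C₃ * C₁ * C₂ * ‖Gamma u.re * Gamma v.re / Gamma (u.re + v.re)‖, fun n => ?_⟩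
  have hterm : ∀ k : ℕ, ‖Gamma (x + n) / Gamma (y + n) * (Gamma (u + k) / Gamma (1 + k) *
      (Gamma (b + n + k) / Gamma (d + n + k)))‖ ≤
      (C₃ * ‖Gamma (1 + v.re + n) / Gamma (1 + n)‖ * C₁ * C₂) *
      ‖Gamma (u.re + k) / Gamma (1 + k) *
        (Gamma (((1 + n : ℝ) : ℂ) + k) / Gamma (((1 + n : ℝ) : ℂ) + u.re + v.re + k))‖ := by
    intro k
    have h2 := h₂ (n + k)
    rw [norm_mul, norm_mul, norm_mul (Gamma (u.re + k) / Gamma (1 + k))]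
    push_cast at h2 ⊢
    rw [← add_assoc, ← add_assoc, ← add_assoc, show (1 + u.re + v.re + (n + k) : ℂ) =
      1 + n + u.re + v.re + k by ring] at h2
    calc _ ≤ (C₃ * ‖Gamma (1 + v.re + n) / Gamma (1 + n)‖) *
        ((C₁ * ‖Gamma (u.re + k) / Gamma (1 + k)‖) *
          (C₂ * ‖Gamma (1 + n + k) / Gamma (1 + n + u.re + v.re + k)‖)) := by
          gcongr
          · exact h₃ n
          · exact h₁ k
      _ = _ := by ring
  have hle := (Summable.of_nonneg_of_le (fun _ => norm_nonneg _) hterm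
    ((hsum n).mul_left _)).tsum_le_tsum hterm ((hsum n).mul_left _)
  rw [tsum_mul_left, tsum_norm_Gamma_div_mul_Gamma_div hu hv (by positivity)] at hle
  refine hle.trans (le_of_eq ?_)
  have hG₁ : Gamma (1 + n : ℂ) ≠ 0 := Gamma_ne_zero_of_re_pos (by simp; positivity)
  have hG₂ : Gamma (1 + n + v.re : ℂ) ≠ 0 := Gamma_ne_zero_of_re_pos (by simp; positivity)
  have hcancel : ‖Gamma (1 + v.re + n) / Gamma (1 + n)‖ *
      ‖Gamma (1 + n : ℂ) / Gamma (1 + n + v.re)‖ = 1 := by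
    rw [← norm_mul, show (1 + v.re + n : ℂ) = 1 + n + v.re by ring, div_mul_div_cancel₀ hG₁,
      div_self hG₂, norm_one]
  rw [norm_mul (Gamma u.re * Gamma v.re / Gamma (u.re + v.re) : ℂ)]
  push_cast
  linear_combination (C₃ * C₁ * C₂ * ‖Gamma u.re * Gamma v.re / Gamma (u.re + v.re)‖) * hcancel

lemma natCast_cpow_tendsto_zero {s : ℂ} (hs : s.re < 0) :
    Tendsto (fun n : ℕ => (n : ℂ) ^ s) atTop (𝓝 0) := by
  rw [tendsto_zero_iff_norm_tendsto_zero]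
  have h := (tendsto_rpow_neg_atTop (y := -s.re) (by linarith)).comp tendsto_natCast_atTop_atTop
  rw [neg_neg] at h
  refine h.congr' ?_
  filter_upwards [eventually_gt_atTop 0] with n hn
  rw [norm_natCast_cpow_of_pos hn, Function.comp_apply]

lemma tendsto_Gamma_div_mul_Gamma_div_zero {z w x y : ℂ} (h : (z - w + (x - y)).re < 0) :
    Tendsto (fun n : ℕ => Gamma (z + n) / Gamma (w + n) * (Gamma (x + n) / Gamma (y + n)))
      atTop (𝓝 0) := by
  refine (((Gamma_add_natCast_div_isEquivalent z w).mul
    (Gamma_add_natCast_div_isEquivalent x y)).congr_right ?_).symm.tendsto_nhds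
      (natCast_cpow_tendsto_zero h)
  filter_upwards [eventually_gt_atTop 0] with n hn
  rw [Pi.mul_apply, ← cpow_add _ _ (by exact_mod_cast hn.ne')]

lemma tendsto_Gamma_div_mul_Gamma_div_one {z w x y : ℂ} (h : z - w + (x - y) = 0) :
    Tendsto (fun n : ℕ => Gamma (z + n) / Gamma (w + n) * (Gamma (x + n) / Gamma (y + n)))
      atTop (𝓝 1) := by
  refine (((Gamma_add_natCast_div_isEquivalent z w).mul
    (Gamma_add_natCast_div_isEquivalent x y)).congr_right ?_).symm.tendsto_nhds
      tendsto_const_nhds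
  filter_upwards [eventually_gt_atTop 0] with n hn
  rw [Pi.mul_apply, ← cpow_add _ _ (by exact_mod_cast hn.ne'), h, cpow_zero]

end

/-- Riemann-sum asymptotics for a sum of Gamma quotients. -/
theorem gamma_quotient_sum_limit (a b d e : ℂ)
    (hre1 : 0 < (a - e + 1).re) (hre2 : 0 < (d + e - a - b - 1).re)
    (h : ∀ z ∈ [a, b, d, e, d - a, d - b, b - e + 1], ∀ m : ℕ, z ≠ -(m : ℂ)) :
    (∀ n : ℕ, Summable fun k : ℕ =>
      ‖Complex.Gamma (a + k) / Complex.Gamma (e + k) *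
        (Complex.Gamma (b + n + k) / Complex.Gamma (d + n + k))‖) ∧
    Tendsto (fun n : ℕ =>
        Complex.Gamma (d - a + n) / Complex.Gamma (b - e + 1 + n) *
          ∑' k : ℕ, Complex.Gamma (a + k) / Complex.Gamma (e + k) *
            (Complex.Gamma (b + n + k) / Complex.Gamma (d + n + k)))
      atTop
      (nhds (Complex.Gamma (a - e + 1) * Complex.Gamma (d + e - a - b - 1) /
        Complex.Gamma (d - b))) := by
  have hsum : ∀ n : ℕ, Summable fun k : ℕ =>
      ‖Gamma (a + k) / Gamma (e + k) * (Gamma (b + n + k) / Gamma (d + n + k))‖ := fun n =>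
    summable_norm_Gamma_div_mul_Gamma_div (by simp at hre2 ⊢; linarith)
  refine ⟨hsum, ?_⟩
  set u := a - e + 1 with hu
  set v := d + e - a - b - 1 with hv
  have hbd : d - b = u + v := by rw [hu, hv]; ring
  have hsum' : ∀ n : ℕ, Summable fun k : ℕ =>
      ‖Gamma (u + k) / Gamma (1 + k) * (Gamma (b + n + k) / Gamma (d + n + k))‖ := fun n =>
    summable_norm_Gamma_div_mul_Gamma_div (by
      rw [show u - 1 + (b + n - (d + n)) = -v - 1 by rw [hu, hv]; ring]
      simp only [sub_re, neg_re, one_re]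
      linarith)
  have hA : ∀ k : ℕ, Gamma (u + k) / Gamma (1 + k) ≠ 0 := fun k =>
    div_ne_zero (Gamma_ne_zero_of_re_pos (by rw [add_re, natCast_re]; positivity))
      (Gamma_ne_zero_of_re_pos (by simp; positivity))
  have hc : Tendsto (fun k : ℕ => Gamma (a + k) / Gamma (e + k) /
      (Gamma (u + k) / Gamma (1 + k)) - 1) atTop (nhds 0) := by
    have := (tendsto_Gamma_div_mul_Gamma_div_one (z := a) (w := e) (x := 1) (y := u)
      (by rw [hu]; ring)).sub_const 1
    rw [sub_self] at this
    refine this.congr fun k => ?_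
    rw [div_div_eq_mul_div, mul_div_assoc]
  obtain ⟨M, hM⟩ := exists_tsum_norm_le (b := b) (d := d) (x := d - a) (y := b - e + 1)
    hre1 hre2 hbd (by rw [hv]; ring)
  have hzero := tendsto_tsum_mul_of_tendsto_zero hc (w := fun n k =>
    Gamma (d - a + n) / Gamma (b - e + 1 + n) *
      (Gamma (u + k) / Gamma (1 + k) * (Gamma (b + n + k) / Gamma (d + n + k)))) (fun k => by
      have := (tendsto_Gamma_div_mul_Gamma_div_zero (z := d - a) (w := b - e + 1) (x := b + k)
        (y := d + k) (by
          rw [show d - a - (b - e + 1) + (b + k - (d + k)) = -u by rw [hu]; ring, neg_re]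
          linarith)).const_mul (Gamma (u + k) / Gamma (1 + k))
      rw [mul_zero] at this
      refine this.congr fun n => ?_
      rw [add_right_comm b, add_right_comm d]
      ring) (fun n => by
      simpa only [norm_mul] using (hsum' n).mul_left _) hM
  have hone := (tendsto_Gamma_div_mul_Gamma_div_one (z := d - a) (w := b - e + 1) (x := b)
    (y := b + v) (by rw [hv]; ring)).const_mul (Gamma u * Gamma v / Gamma (u + v))
  have hlim := hzero.add hone
  rw [zero_add, mul_one] at hlim
  rw [hbd]
  refine hlim.congr' ?_
  filter_upwards [eventually_gt_atTop ⌈-b.re⌉₊] with n hn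
  have hbn : 0 < (b + n).re := by
    have := Nat.lt_of_ceil_lt hn
    simp
    linarith
  have hG := (hasSum_Gamma_div_mul_Gamma_div hre1 hre2 hbn).tsum_eq
  rw [show b + n + u + v = d + n by rw [hu, hv]; ring, add_right_comm b] at hG
  have hsplit : ∀ k : ℕ, (Gamma (a + k) / Gamma (e + k) / (Gamma (u + k) / Gamma (1 + k)) - 1) *
      (Gamma (d - a + n) / Gamma (b - e + 1 + n) *
      (Gamma (u + k) / Gamma (1 + k) * (Gamma (b + n + k) / Gamma (d + n + k)))) =
      Gamma (d - a + n) / Gamma (b - e + 1 + n) *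
      (Gamma (a + k) / Gamma (e + k) * (Gamma (b + n + k) / Gamma (d + n + k)) -
      Gamma (u + k) / Gamma (1 + k) * (Gamma (b + n + k) / Gamma (d + n + k))) := by
    intro k
    have h1 := div_mul_cancel₀ (Gamma (a + k) / Gamma (e + k)) (hA k)
    linear_combination (Gamma (d - a + n) / Gamma (b - e + 1 + n)) *
      (Gamma (b + n + k) / Gamma (d + n + k)) * h1
  simp only [hsplit]
  rw [tsum_mul_left, (hsum n).of_norm.tsum_sub (hsum' n).of_norm, hG]
  ring
end
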